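/- Let α ∈ ℝ, b ≥ 0 and a > 0. There exist σ > 0 and a constant C such that for every 0 < T < 1 and every f with finite X_{0,b} norm whose support is contained in ℝ² × [−T,T] (i.e. f(x,y,t) = 0 for |t| > T), one has ‖f‖_{X_{0,b−a}} ≤ C T^{σ} ‖f‖_{X_{0,b}}. -/

import Mathlib

open MeasureTheory ENNReal NNReal

/-- The dispersion relation of the fifth order KP-I equation with parameter `α`:
`ω(ξ,μ) = ξ⁵ − αξ³ + μ²/ξ` (for `ξ ≠ 0`). -/
noncomputable def omega5 (α ξ μ : ℝ) : ℝ := ξ ^ 5 - α * ξ ^ 3 + μ ^ 2 / ξ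

/-- The space-time Fourier transform on `ℝ³`, with the unitary normalization
`f̂(ξ,μ,τ) = (2π)^{-3/2} ∫ f(x,y,t) e^{−i(xξ+yμ+tτ)} dx dy dt`. -/
noncomputable def ft3 (f : ℝ × ℝ × ℝ → ℂ) (ξ μ τ : ℝ) : ℂ :=
  (((2 * Real.pi) ^ (-(3 : ℝ) / 2) : ℝ) : ℂ) *
    ∫ q : ℝ × ℝ × ℝ,
      f q * Complex.exp (-Complex.I * ((q.1 * ξ + q.2.1 * μ + q.2.2 * τ : ℝ) : ℂ))

/-- The dyadic modulation cutoffs: `χ₀` is the indicator of `{|λ| ≤ 1}` and,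
for `j ≥ 1`, `χ_j` is the indicator of `{2^{j−1} ≤ |λ| ≤ 2^j}`. -/
noncomputable def chi (j : ℕ) (lam : ℝ) : ℝ :=
  if j = 0 then (if |lam| ≤ 1 then 1 else 0)
  else (if (2 : ℝ) ^ (j - 1) ≤ |lam| ∧ |lam| ≤ (2 : ℝ) ^ j then 1 else 0)

/-- The weight `(1 + |ξ|² + |μ|/|ξ|)^s`. -/
noncomputable def wgt (s ξ μ : ℝ) : ℝ := (1 + ξ ^ 2 + |μ| / |ξ|) ^ s

/-- The Bourgain norm
`‖f‖_{X_{s,b}} = Σ_{j≥0} 2^{jb} ‖χ_j(τ−ω(ξ,μ)) (1+|ξ|²+|μ|/|ξ|)^s f̂‖_{L²(ℝ³)}`. -/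
noncomputable def XNorm (α s b : ℝ) (f : ℝ × ℝ × ℝ → ℂ) : ℝ≥0∞ :=
  ∑' j : ℕ, ENNReal.ofReal ((2 : ℝ) ^ ((j : ℝ) * b)) *
    eLpNorm (fun q : ℝ × ℝ × ℝ =>
      ((chi j (q.2.2 - omega5 α q.1 q.2.1) * wgt s q.1 q.2.1 : ℝ) : ℂ) *
        ft3 f q.1 q.2.1 q.2.2) 2 volume

/-- A kernel whose inverse Fourier transform is `1` on `[-1,1]`. -/
lemma exists_kernel : ∃ ψ : SchwartzMap ℝ ℂ, ∀ t : ℝ, |t| ≤ 1 →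
    ∫ v : ℝ, Complex.exp (((2 * Real.pi * (v * t) : ℝ) : ℂ) * Complex.I) * ψ v = 1 := by
  let g : ContDiffBump (0 : ℝ) := ⟨1, 2, by norm_num, by norm_num⟩
  have h1 : HasCompactSupport (fun x : ℝ => ((g x : ℝ) : ℂ)) :=
    g.hasCompactSupport.comp_left (g := fun x : ℝ => (x : ℂ)) (by simp)
  have h2 : ContDiff ℝ ((⊤ : ℕ∞) : WithTop ℕ∞) (fun x : ℝ => ((g x : ℝ) : ℂ)) :=
    Complex.ofRealCLM.contDiff.comp g.contDiff
  let φ : SchwartzMap ℝ ℂ := h1.toSchwartzMap h2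
  refine ⟨FourierTransform.fourier φ, fun t ht => ?_⟩
  have h3 : (FourierTransformInv.fourierInv (FourierTransform.fourier φ)) t = φ t := by simp
  rw [SchwartzMap.fourierInv_coe, Real.fourierInv_eq'] at h3
  have h4 : φ t = 1 := by
    have : g t = 1 := g.one_of_mem_closedBall (by simpa [g] using ht)
    change ((g t : ℝ) : ℂ) = 1
    simp [this]
  rw [h4] at h3
  rw [← h3]
  refine integral_congr_ae (Filter.Eventually.of_forall fun v => ?_)
  simp [mul_comm]

lemma norm_exp_phase (x : ℝ) : ‖Complex.exp (-Complex.I * (x : ℂ))‖ = 1 := by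
  have := Complex.norm_exp_ofReal_mul_I (-x)
  rw [← this]; congr 2; push_cast; ring

lemma ft3_zero_of_not_integrable (f : ℝ × ℝ × ℝ → ℂ) (hf : ¬ Integrable f) (ξ μ τ : ℝ) :
    ft3 f ξ μ τ = 0 := by
  unfold ft3
  rw [integral_undef, mul_zero]
  intro h
  apply hf
  have hc : Continuous fun q : ℝ × ℝ × ℝ =>
      Complex.exp (Complex.I * ((q.1 * ξ + q.2.1 * μ + q.2.2 * τ : ℝ) : ℂ)) := by fun_prop
  have h2 := h.mul_bdd (c := 1) hc.aestronglyMeasurable (Filter.Eventually.of_forall fun q => by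
    have := norm_exp_phase (-(q.1 * ξ + q.2.1 * μ + q.2.2 * τ))
    rw [← this]; apply le_of_eq; congr 2; push_cast; ring)
  refine h2.congr (Filter.Eventually.of_forall fun q => ?_)
  simp only
  rw [mul_assoc, ← Complex.exp_add]
  simp

lemma ft3_continuous (f : ℝ × ℝ × ℝ → ℂ) (hf : Integrable f) :
    Continuous fun q : ℝ × ℝ × ℝ => ft3 f q.1 q.2.1 q.2.2 := by
  unfold ft3
  refine continuous_const.mul ?_
  refine continuous_of_dominated (bound := fun p => ‖f p‖) ?_ ?_ hf.norm ?_
  · intro q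
    refine hf.aestronglyMeasurable.mul (Continuous.aestronglyMeasurable ?_)
    fun_prop
  · intro q
    refine Filter.Eventually.of_forall fun p => ?_
    rw [norm_mul, norm_exp_phase, mul_one]
  · refine Filter.Eventually.of_forall fun p => ?_
    fun_prop

/-- reproducing formula -/
lemma ft3_repro (ψ : SchwartzMap ℝ ℂ) (hψ : ∀ t : ℝ, |t| ≤ 1 →
    ∫ v : ℝ, Complex.exp (((2 * Real.pi * (v * t) : ℝ) : ℂ) * Complex.I) * ψ v = 1)
    (f : ℝ × ℝ × ℝ → ℂ) (hf : Integrable f) (T : ℝ) (hT : 0 < T)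
    (hs : ∀ q : ℝ × ℝ × ℝ, T < |q.2.2| → f q = 0) (ξ μ τ : ℝ) :
    ft3 f ξ μ τ = ∫ v : ℝ, ψ v * ft3 f ξ μ (τ - 2 * Real.pi / T * v) := by
  unfold ft3
  have e1 : ∀ v : ℝ, ψ v * ((((2 * Real.pi) ^ (-(3 : ℝ) / 2) : ℝ) : ℂ) * ∫ q : ℝ × ℝ × ℝ,
      f q * Complex.exp (-Complex.I * ((q.1 * ξ + q.2.1 * μ +
        q.2.2 * (τ - 2 * Real.pi / T * v) : ℝ) : ℂ))) =
      (((2 * Real.pi) ^ (-(3 : ℝ) / 2) : ℝ) : ℂ) * ∫ q : ℝ × ℝ × ℝ,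
      ψ v * (f q * Complex.exp (-Complex.I * ((q.1 * ξ + q.2.1 * μ +
        q.2.2 * (τ - 2 * Real.pi / T * v) : ℝ) : ℂ))) := by
    intro v
    rw [integral_const_mul]; ring
  simp_rw [e1]
  rw [integral_const_mul]
  congr 1
  rw [integral_integral_swap]
  · refine integral_congr_ae (Filter.Eventually.of_forall fun q => ?_)
    simp only
    by_cases hq : T < |q.2.2|
    · simp [hs q hq]
    have hq' : |q.2.2 / T| ≤ 1 := by
      rw [abs_div, abs_of_pos hT, div_le_one hT]; exact not_lt.mp hq
    have h1 := hψ _ hq'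
    conv_lhs => rw [← mul_one (f q * _), ← h1]
    rw [← integral_const_mul]
    refine integral_congr_ae (Filter.Eventually.of_forall fun v => ?_)
    simp only
    have : Complex.exp (-Complex.I * ((q.1 * ξ + q.2.1 * μ +
        q.2.2 * (τ - 2 * Real.pi / T * v) : ℝ) : ℂ)) =
        Complex.exp (-Complex.I * ((q.1 * ξ + q.2.1 * μ + q.2.2 * τ : ℝ) : ℂ)) *
        Complex.exp (((2 * Real.pi * (v * (q.2.2 / T)) : ℝ) : ℂ) * Complex.I) := by
      rw [← Complex.exp_add]; congr 1; push_cast; ring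
    rw [this]; ring
  · have h := (ψ.integrable (μ := volume)).mul_prod hf
    have hc : Continuous fun z : ℝ × (ℝ × ℝ × ℝ) =>
      Complex.exp (-Complex.I * ((z.2.1 * ξ + z.2.2.1 * μ +
        z.2.2.2 * (τ - 2 * Real.pi / T * z.1) : ℝ) : ℂ)) := by fun_prop
    have h2 := h.mul_bdd (c := 1) hc.aestronglyMeasurable (Filter.Eventually.of_forall fun q =>
      (norm_exp_phase _).le)
    refine h2.congr (Filter.Eventually.of_forall fun z => ?_)
    simp only [Function.uncurry]
    ring

lemma lintegral_affine (g : ℝ → ℝ≥0∞) (hg : Measurable g) (τ c : ℝ) (hc : 0 < c) :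
    ∫⁻ v, g (τ - c * v) = ENNReal.ofReal c⁻¹ * ∫⁻ v, g v := by
  have h := lintegral_map (μ := volume) (f := fun x => g (τ - x)) (g := fun x : ℝ => c * x)
    (by fun_prop) (by fun_prop)
  rw [← h, Real.map_volume_mul_left hc.ne', lintegral_smul_measure, lintegral_sub_left_eq_self,
    abs_of_pos (inv_pos.mpr hc), smul_eq_mul]

lemma sq_lintegral_mul_le (u w : ℝ → ℝ≥0∞) (hu : Measurable u) (hw : Measurable w) :
    (∫⁻ v, u v * w v) ^ 2 ≤ (∫⁻ v, u v ^ 2) * ∫⁻ v, w v ^ 2 := by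
  have h := ENNReal.lintegral_mul_le_Lp_mul_Lq volume Real.HolderConjugate.two_two
    hu.aemeasurable hw.aemeasurable
  have h2 := pow_le_pow_left₀ (zero_le) h 2
  refine h2.trans (le_of_eq ?_)
  rw [mul_pow]
  simp only [← ENNReal.rpow_natCast, ← ENNReal.rpow_mul]
  norm_num

lemma ft3_pointwise (ψ : SchwartzMap ℝ ℂ) (hψ : ∀ t : ℝ, |t| ≤ 1 →
    ∫ v : ℝ, Complex.exp (((2 * Real.pi * (v * t) : ℝ) : ℂ) * Complex.I) * ψ v = 1)
    (f : ℝ × ℝ × ℝ → ℂ) (hf : Integrable f) (T : ℝ) (hT : 0 < T)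
    (hs : ∀ q : ℝ × ℝ × ℝ, T < |q.2.2| → f q = 0) (ξ μ τ : ℝ) :
    ‖ft3 f ξ μ τ‖ₑ ^ 2 ≤ (∫⁻ v, ‖ψ v‖ₑ ^ 2) * (ENNReal.ofReal T *
      ∫⁻ v, ‖ft3 f ξ μ v‖ₑ ^ 2) := by
  have hF := ft3_continuous f hf
  have hF1 : Continuous fun v => ft3 f ξ μ v :=
    hF.comp (g := fun q : ℝ × ℝ × ℝ => ft3 f q.1 q.2.1 q.2.2) (f := fun v => (ξ, μ, v))
      (by fun_prop)
  have hF2 : Continuous fun v => ft3 f ξ μ (τ - 2 * Real.pi / T * v) :=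
    hF1.comp (g := fun v => ft3 f ξ μ v) (by fun_prop)
  have hc : 0 < 2 * Real.pi / T := by positivity
  have h1 : ‖ft3 f ξ μ τ‖ₑ ≤ ∫⁻ v, ‖ψ v‖ₑ * ‖ft3 f ξ μ (τ - 2 * Real.pi / T * v)‖ₑ := by
    rw [ft3_repro ψ hψ f hf T hT hs ξ μ τ]
    refine (enorm_integral_le_lintegral_enorm _).trans (le_of_eq ?_)
    simp only [enorm_mul]
  refine (pow_le_pow_left₀ zero_le h1 2).trans ?_
  refine (sq_lintegral_mul_le _ _ ψ.continuous.measurable.enorm hF2.measurable.enorm).trans ?_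
  gcongr
  rw [lintegral_affine (fun v => ‖ft3 f ξ μ v‖ₑ ^ 2) (hF1.measurable.enorm.pow_const 2) τ _ hc]
  gcongr
  rw [inv_div]
  apply div_le_self hT.le
  nlinarith [Real.pi_gt_three]

lemma chi_measurable (j : ℕ) : Measurable (chi j) := by
  unfold chi
  split_ifs
  · exact Measurable.ite (measurableSet_le (by fun_prop) (by fun_prop)) (by fun_prop) (by fun_prop)
  · refine Measurable.ite ?_ (by fun_prop) (by fun_prop)
    have h1 : MeasurableSet {x : ℝ | (2 : ℝ) ^ (j - 1) ≤ |x|} :=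
      measurableSet_le (by fun_prop) (by fun_prop)
    have h2 : MeasurableSet {x : ℝ | |x| ≤ (2 : ℝ) ^ j} :=
      measurableSet_le (by fun_prop) (by fun_prop)
    exact h1.inter h2

lemma chi_le_indicator (j : ℕ) (c x : ℝ) : ‖((chi j (x - c) : ℝ) : ℂ)‖ₑ ^ 2 ≤
    (Set.Icc (c - 2 ^ j) (c + 2 ^ j)).indicator (fun _ => (1 : ℝ≥0∞)) x := by
  by_cases hx : x ∈ Set.Icc (c - 2 ^ j) (c + 2 ^ j)
  · rw [Set.indicator_of_mem hx]
    unfold chi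
    split_ifs <;> simp
  · have : ¬ |x - c| ≤ 2 ^ j := by
      intro h; apply hx; rw [abs_le] at h; constructor <;> linarith [h.1, h.2]
    have : chi j (x - c) = 0 := by
      unfold chi
      split_ifs with h1 h2 h3
      · subst h1; simp at this; linarith
      · rfl
      · exact absurd h3.2 this
      · rfl
    simp [this]

lemma lintegral_chi_le (j : ℕ) (c : ℝ) :
    ∫⁻ x, ‖((chi j (x - c) : ℝ) : ℂ)‖ₑ ^ 2 ≤ ENNReal.ofReal (2 * 2 ^ j) := by
  refine (lintegral_mono (chi_le_indicator j c)).trans ?_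
  rw [lintegral_indicator measurableSet_Icc]
  simp only [lintegral_const, Measure.restrict_apply MeasurableSet.univ, Set.univ_inter, one_mul,
    Real.volume_Icc]
  apply le_of_eq; congr 1; ring

lemma chi_cover (x : ℝ) : ∃ j, chi j x = 1 := by
  by_cases h : |x| ≤ 1
  · exact ⟨0, by simp [chi, h]⟩
  · push Not at h
    obtain ⟨n, h1, h2⟩ := exists_nat_pow_near h.le (by norm_num : (1 : ℝ) < 2)
    exact ⟨n + 1, by simp [chi, h1, h2.le]⟩

lemma one_le_tsum_chi (x : ℝ) : 1 ≤ ∑' j, ‖((chi j x : ℝ) : ℂ)‖ₑ ^ 2 := by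
  obtain ⟨j, hj⟩ := chi_cover x
  refine le_trans ?_ (ENNReal.le_tsum j)
  simp [hj]

lemma tsum_sq_le (N : ℕ → ℝ≥0∞) : ∑' j, N j ^ 2 ≤ (∑' j, N j) ^ 2 := by
  rw [sq (∑' j, N j), ← ENNReal.tsum_mul_right]
  refine ENNReal.tsum_le_tsum fun j => ?_
  rw [sq]
  gcongr
  exact ENNReal.le_tsum j

lemma eLpNorm_two_sq (g : ℝ × ℝ × ℝ → ℂ) : eLpNorm g 2 volume ^ 2 = ∫⁻ q, ‖g q‖ₑ ^ 2 := by
  have := eLpNorm_nnreal_pow_eq_lintegral (μ := volume) (f := g) (p := 2) (by norm_num)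
  simpa using this

lemma omega_meas (α : ℝ) : Measurable fun q : ℝ × ℝ × ℝ => q.2.2 - omega5 α q.1 q.2.1 := by
  unfold omega5; fun_prop

/-- The dyadic pieces. -/
noncomputable def piece (α : ℝ) (f : ℝ × ℝ × ℝ → ℂ) (j : ℕ) : ℝ≥0∞ :=
  eLpNorm (fun q : ℝ × ℝ × ℝ =>
      ((chi j (q.2.2 - omega5 α q.1 q.2.1) * wgt 0 q.1 q.2.1 : ℝ) : ℂ) *
        ft3 f q.1 q.2.1 q.2.2) 2 volume

lemma piece_sq (α : ℝ) (f : ℝ × ℝ × ℝ → ℂ) (j : ℕ) : piece α f j ^ 2 =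
    ∫⁻ q : ℝ × ℝ × ℝ, ‖((chi j (q.2.2 - omega5 α q.1 q.2.1) : ℝ) : ℂ)‖ₑ ^ 2 *
      ‖ft3 f q.1 q.2.1 q.2.2‖ₑ ^ 2 := by
  unfold piece
  rw [eLpNorm_two_sq]
  simp only [wgt, Real.rpow_zero, mul_one, enorm_mul, mul_pow]

lemma lintegral_le_tsum_piece (α : ℝ) (f : ℝ × ℝ × ℝ → ℂ) (hf : Integrable f) :
    ∫⁻ q : ℝ × ℝ × ℝ, ‖ft3 f q.1 q.2.1 q.2.2‖ₑ ^ 2 ≤ (∑' j, piece α f j) ^ 2 := by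
  refine le_trans ?_ (tsum_sq_le _)
  simp_rw [piece_sq]
  have hF := ft3_continuous f hf
  rw [← lintegral_tsum]
  · refine lintegral_mono fun q => ?_
    simp only
    rw [ENNReal.tsum_mul_right]
    exact le_mul_of_one_le_left zero_le (one_le_tsum_chi _)
  · intro j
    have := (chi_measurable j).comp (omega_meas α)
    simp only [Function.comp_def] at this
    exact ((Complex.measurable_ofReal.comp this).enorm.pow_const 2).mul
      (hF.measurable.enorm.pow_const 2) |>.aemeasurable

lemma lintegral_triple (g : ℝ × ℝ × ℝ → ℝ≥0∞) (hg : Measurable g) :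
    ∫⁻ q, g q = ∫⁻ x, ∫⁻ y, ∫⁻ t, g (x, y, t) := by
  rw [Measure.volume_eq_prod, lintegral_prod _ hg.aemeasurable]
  refine lintegral_congr fun x => ?_
  rw [Measure.volume_eq_prod, lintegral_prod _ (by fun_prop)]

lemma piece_sq_le (ψ : SchwartzMap ℝ ℂ) (hψ : ∀ t : ℝ, |t| ≤ 1 →
    ∫ v : ℝ, Complex.exp (((2 * Real.pi * (v * t) : ℝ) : ℂ) * Complex.I) * ψ v = 1)
    (α : ℝ) (f : ℝ × ℝ × ℝ → ℂ) (hf : Integrable f) (T : ℝ) (hT : 0 < T)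
    (hs : ∀ q : ℝ × ℝ × ℝ, T < |q.2.2| → f q = 0) (j : ℕ) :
    piece α f j ^ 2 ≤ ENNReal.ofReal (2 * 2 ^ j) * ((∫⁻ v, ‖ψ v‖ₑ ^ 2) * ENNReal.ofReal T) *
      (∑' j, piece α f j) ^ 2 := by
  refine le_trans ?_ (mul_le_mul_right (lintegral_le_tsum_piece α f hf) _)
  have hF := ft3_continuous f hf
  have hm := (chi_measurable j).comp (omega_meas α)
  simp only [Function.comp_def] at hm
  have hFm : Measurable fun q : ℝ × ℝ × ℝ => ‖ft3 f q.1 q.2.1 q.2.2‖ₑ ^ 2 :=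
    hF.measurable.enorm.pow_const 2
  have hPm : Measurable fun q : ℝ × ℝ × ℝ =>
      ‖((chi j (q.2.2 - omega5 α q.1 q.2.1) : ℝ) : ℂ)‖ₑ ^ 2 * ‖ft3 f q.1 q.2.1 q.2.2‖ₑ ^ 2 :=
    ((Complex.measurable_ofReal.comp hm).enorm.pow_const 2).mul hFm
  rw [piece_sq, ← lintegral_const_mul _ hFm, 
    lintegral_triple _ hPm,
    lintegral_triple _ (hFm.const_mul _)]
  refine lintegral_mono fun x => lintegral_mono fun y => ?_
  simp only
  have hF1 : Continuous fun v => ft3 f x y v :=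
    hF.comp (g := fun q : ℝ × ℝ × ℝ => ft3 f q.1 q.2.1 q.2.2) (f := fun v => (x, y, v))
      (by fun_prop)
  rw [lintegral_const_mul _ (hF1.measurable.enorm.pow_const 2)]
  calc _ ≤ ∫⁻ t, ‖((chi j (t - omega5 α x y) : ℝ) : ℂ)‖ₑ ^ 2 *
        ((∫⁻ v, ‖ψ v‖ₑ ^ 2) * (ENNReal.ofReal T * ∫⁻ v, ‖ft3 f x y v‖ₑ ^ 2)) := by
        refine lintegral_mono fun t => ?_
        simp only
        gcongr
        exact ft3_pointwise ψ hψ f hf T hT hs x y t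
    _ = (∫⁻ t, ‖((chi j (t - omega5 α x y) : ℝ) : ℂ)‖ₑ ^ 2) *
        ((∫⁻ v, ‖ψ v‖ₑ ^ 2) * (ENNReal.ofReal T * ∫⁻ v, ‖ft3 f x y v‖ₑ ^ 2)) := by
        rw [lintegral_mul_const]
        have := (chi_measurable j).comp (measurable_id.sub_const (omega5 α x y))
        simp only [Function.comp_def, id] at this
        exact (Complex.measurable_ofReal.comp this).enorm.pow_const 2
    _ ≤ _ := by
        rw [mul_assoc, mul_assoc]
        gcongr
        exact lintegral_chi_le _ _

/-- Low-modulation bound with a real constant. -/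
lemma exists_piece_bound : ∃ B : ℝ, 0 < B ∧ ∀ (α : ℝ) (f : ℝ × ℝ × ℝ → ℂ), Integrable f →
    ∀ T : ℝ, 0 < T → (∀ q : ℝ × ℝ × ℝ, T < |q.2.2| → f q = 0) → ∀ j : ℕ,
    piece α f j ≤ ENNReal.ofReal (B * T ^ (1 / 2 : ℝ) * 2 ^ ((j : ℝ) * (1 / 2))) *
      ∑' j, piece α f j := by
  obtain ⟨ψ, hψ⟩ := exists_kernel
  have hA : ∫⁻ v, ‖ψ v‖ₑ ^ 2 < ⊤ := by
    have h := (ψ.memLp 2 volume).eLpNorm_lt_top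
    have := eLpNorm_nnreal_pow_eq_lintegral (μ := volume) (f := ψ) (p := 2) (by norm_num)
    have h2 : eLpNorm ψ 2 volume ^ 2 = ∫⁻ q, ‖ψ q‖ₑ ^ 2 := by simpa using this
    rw [← h2]
    exact ENNReal.pow_lt_top h
  set A := ∫⁻ v, ‖ψ v‖ₑ ^ 2 with hAdef
  refine ⟨2 * A.toReal + 1, by positivity, fun α f hf T hT hs j => ?_⟩
  have h := piece_sq_le ψ hψ α f hf T hT hs j
  rw [← hAdef, ← ENNReal.ofReal_toReal hA.ne] at h
  rw [← ENNReal.ofReal_mul (by positivity), ← ENNReal.ofReal_mul (by positivity)] at h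
  rw [← ENNReal.pow_le_pow_left_iff (two_ne_zero)]
  refine h.trans ?_
  rw [mul_pow, ← ENNReal.ofReal_pow (by positivity)]
  gcongr
  rw [mul_pow, mul_pow]
  have e1 : (T ^ (1 / 2 : ℝ)) ^ 2 = T := by
    rw [← Real.rpow_natCast, ← Real.rpow_mul hT.le]; norm_num
  have e2 : ((2 : ℝ) ^ ((j : ℝ) * (1 / 2))) ^ 2 = 2 ^ j := by
    rw [← Real.rpow_natCast, ← Real.rpow_mul (by norm_num)]
    have : (j : ℝ) * (1 / 2) * ((2 : ℕ) : ℝ) = (j : ℝ) := by push_cast; ring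
    rw [this, Real.rpow_natCast]
  rw [e1, e2]
  have : 2 * A.toReal ≤ (2 * A.toReal + 1) ^ 2 := by
    nlinarith [ENNReal.toReal_nonneg (a := A)]
  have h3 : 0 ≤ T * 2 ^ j := by positivity
  nlinarith [mul_le_mul_of_nonneg_right this h3]

/-- Termwise real-exponent comparison. -/
lemma coef_dichotomy (a b θ T : ℝ) (hb : 0 ≤ b) (ha : 0 < a) (hT : 0 < T)
    (hθb : θ * (b + 1 / 2) = 1 / 4) (j : ℕ) :
    (2 : ℝ) ^ ((j : ℝ) * (b - a)) ≤ T ^ (θ * a) * 2 ^ ((j : ℝ) * b) ∨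
    (2 : ℝ) ^ ((j : ℝ) * (b - a)) * (T ^ (1 / 2 : ℝ) * 2 ^ ((j : ℝ) * (1 / 2))) ≤
      T ^ (1 / 4 : ℝ) * ((2 : ℝ) ^ (-a)) ^ j := by
  set x : ℝ := (2 : ℝ) ^ (j : ℝ) with hx
  have hx0 : 0 < x := by positivity
  have e : ∀ c : ℝ, (2 : ℝ) ^ ((j : ℝ) * c) = x ^ c := fun c => by
    rw [hx, ← Real.rpow_mul (by norm_num)]
  have e3 : ((2 : ℝ) ^ (-a)) ^ j = x ^ (-a) := by
    rw [← e, ← Real.rpow_natCast, ← Real.rpow_mul (by norm_num), mul_comm]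
  rw [e3]
  simp only [e]
  rcases le_total (T ^ (-θ)) x with h | h
  · left
    have h1 : x ^ (-a) ≤ (T ^ (-θ)) ^ (-a) :=
      Real.rpow_le_rpow_of_nonpos (by positivity) h (by linarith)
    rw [← Real.rpow_mul hT.le, neg_mul_neg] at h1
    have : x ^ (b - a) = x ^ (-a) * x ^ b := by rw [← Real.rpow_add hx0]; congr 1; ring
    rw [this]
    gcongr
  · right
    have h1 : x ^ (b + 1 / 2) ≤ (T ^ (-θ)) ^ (b + 1 / 2) := by gcongr
    rw [← Real.rpow_mul hT.le, neg_mul, hθb] at h1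
    have e4 : x ^ (b - a) * (T ^ (1 / 2 : ℝ) * x ^ (1 / 2 : ℝ)) =
        T ^ (1 / 2 : ℝ) * x ^ (b + 1 / 2) * x ^ (-a) := by
      have : x ^ (b - a) * x ^ (1 / 2 : ℝ) = x ^ (b + 1 / 2) * x ^ (-a) := by
        rw [← Real.rpow_add hx0, ← Real.rpow_add hx0]; congr 1; ring
      calc _ = T ^ (1 / 2 : ℝ) * (x ^ (b - a) * x ^ (1 / 2 : ℝ)) := by ring
        _ = _ := by rw [this]; ring
    rw [e4]
    have e5 : T ^ (1 / 4 : ℝ) = T ^ (1 / 2 : ℝ) * T ^ (-(1 / 4) : ℝ) := by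
      rw [← Real.rpow_add hT]; norm_num
    rw [e5]
    gcongr

/-- Proposition 2.6: a function supported in `ℝ² × [−T,T]` gains a positive
power of `T` when the modulation exponent of its Bourgain norm is lowered:
`‖f‖_{X_{0,b−a}} ≤ C T^σ ‖f‖_{X_{0,b}}`. -/
theorem time_localization_gain (α b a : ℝ) (hb : 0 ≤ b) (ha : 0 < a) :
    ∃ σ : ℝ, 0 < σ ∧ ∃ C : ℝ, 0 < C ∧
      ∀ T : ℝ, 0 < T → T < 1 →
        ∀ f : ℝ × ℝ × ℝ → ℂ,
          (∀ q : ℝ × ℝ × ℝ, T < |q.2.2| → f q = 0) →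
          XNorm α 0 b f < ⊤ →
          XNorm α 0 (b - a) f ≤ ENNReal.ofReal (C * T ^ σ) * XNorm α 0 b f := by
  obtain ⟨B, hB, hpiece⟩ := exists_piece_bound
  set θ : ℝ := 1 / 4 / (b + 1 / 2) with hθ
  have hθb : θ * (b + 1 / 2) = 1 / 4 := by rw [hθ]; field_simp
  have hθ0 : 0 < θ := by positivity
  have hr0 : (0 : ℝ) ≤ 2 ^ (-a) := by positivity
  have hr1 : (2 : ℝ) ^ (-a) < 1 := Real.rpow_lt_one_of_one_lt_of_neg (by norm_num) (by linarith)
  have hG : 0 < (1 - (2 : ℝ) ^ (-a))⁻¹ := inv_pos.mpr (by linarith)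
  refine ⟨min (θ * a) (1 / 4), by positivity, 1 + B * (1 - (2 : ℝ) ^ (-a))⁻¹, by positivity, ?_⟩
  intro T hT hT1 f hs _
  set σ := min (θ * a) (1 / 4) with hσ
  by_cases hf : Integrable f
  swap
  · have : XNorm α 0 (b - a) f = 0 := by
      unfold XNorm
      simp [ft3_zero_of_not_integrable f hf]
    rw [this]; exact zero_le
  have hX : ∀ c, XNorm α 0 c f = ∑' j : ℕ, ENNReal.ofReal ((2 : ℝ) ^ ((j : ℝ) * c)) *
    piece α f j := fun c => rfl
  have hS : ∑' j, piece α f j ≤ XNorm α 0 b f := by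
    rw [hX]
    refine ENNReal.tsum_le_tsum fun j => ?_
    conv_lhs => rw [← one_mul (piece α f j)]
    gcongr
    rw [ENNReal.one_le_ofReal]
    exact Real.one_le_rpow (by norm_num) (by positivity)
  have t1 : T ^ (θ * a) ≤ T ^ σ := Real.rpow_le_rpow_of_exponent_ge hT hT1.le (min_le_left _ _)
  have t2 : T ^ (1 / 4 : ℝ) ≤ T ^ σ :=
    Real.rpow_le_rpow_of_exponent_ge hT hT1.le (min_le_right _ _)
  have hterm : ∀ j : ℕ, ENNReal.ofReal ((2 : ℝ) ^ ((j : ℝ) * (b - a))) * piece α f j ≤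
      ENNReal.ofReal (T ^ σ) * (ENNReal.ofReal ((2 : ℝ) ^ ((j : ℝ) * b)) * piece α f j) +
      ENNReal.ofReal (((2 : ℝ) ^ (-a)) ^ j) * (ENNReal.ofReal (B * T ^ σ) * XNorm α 0 b f) := by
    intro j
    rcases coef_dichotomy a b θ T hb ha hT hθb j with h | h
    · refine le_trans ?_ le_self_add
      rw [← mul_assoc, ← ENNReal.ofReal_mul (by positivity)]
      gcongr
      refine h.trans ?_
      gcongr
    · refine le_trans ?_ le_add_self
      have h1 := (hpiece α f hf T hT hs j).trans (mul_le_mul_right hS _)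
      refine (mul_le_mul_right h1 _).trans ?_
      rw [← mul_assoc, ← mul_assoc, ← ENNReal.ofReal_mul (by positivity),
        ← ENNReal.ofReal_mul (by positivity)]
      refine mul_le_mul_left (ENNReal.ofReal_le_ofReal ?_) _
      calc (2 : ℝ) ^ ((j : ℝ) * (b - a)) * (B * T ^ (1 / 2 : ℝ) * 2 ^ ((j : ℝ) * (1 / 2))) = B * ((2 : ℝ) ^ ((j : ℝ) * (b - a)) *
            (T ^ (1 / 2 : ℝ) * 2 ^ ((j : ℝ) * (1 / 2)))) := by ring
        _ ≤ B * (T ^ (1 / 4 : ℝ) * ((2 : ℝ) ^ (-a)) ^ j) := by gcongr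
        _ ≤ B * (T ^ σ * ((2 : ℝ) ^ (-a)) ^ j) := by gcongr
        _ = _ := by ring
  rw [hX (b - a)]
  refine (ENNReal.tsum_le_tsum hterm).trans ?_
  rw [ENNReal.tsum_add, ENNReal.tsum_mul_left, ENNReal.tsum_mul_right, ← hX b,
    ← ENNReal.ofReal_tsum_of_nonneg (fun n => by positivity)
      (summable_geometric_of_lt_one hr0 hr1), tsum_geometric_of_lt_one hr0 hr1, ← mul_assoc,
    ← ENNReal.ofReal_mul (by positivity), ← add_mul, ← ENNReal.ofReal_add (by positivity)
      (by positivity)]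
  apply le_of_eq
  congr 2
  ring
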